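/- Let p > 1 and β > 0, and for each D > 0 let α(D) be the unique positive solution of ∫₀^{π_p/2} dφ / (α + β·cos_p(φ)^{p−1}·sin_p(φ)) = D, and set λ̄(D) = (p−1)·α(D)^p. Then there exist constants C > 0 and D₀ > 0 such that for all D > D₀, |ln λ̄(D) + (p−1)·β·D| ≤ C. -/

import Mathlib

open Real MeasureTheory Set

/-- `arcsin_p(x) = ∫₀ˣ (1 - s^p)^(-1/p) ds`. -/
noncomputable def arcsinP (p x : ℝ) : ℝ := ∫ s in (0:ℝ)..x, (1 - s ^ p) ^ (-1 / p)

/-- `π_p = 2 arcsin_p(1)`. -/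
noncomputable def piP (p : ℝ) : ℝ := 2 * arcsinP p 1

lemma weighted_inv_defect_bounds {a b s t C c : ℝ} (ha : 0 < a) (hb : 0 < b)
    (hs0 : 0 ≤ s) (hs1 : s ≤ 1) (ht0 : 0 ≤ t) (ht1 : t ≤ 1) (hC0 : 0 ≤ C) (hC1 : C ≤ 1)
    (hc0 : 0 ≤ c) (hc1 : c ≤ 1) (h : C * c + s * t = 1) :
    0 ≤ C / (a + b * s) + t / (a + b * c) - 1 / (a + b * c * s) ∧
      C / (a + b * s) + t / (a + b * c) - 1 / (a + b * c * s) ≤ 2 / b := by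
  have h1 : 0 < a + b * s := by positivity
  have h2 : 0 < a + b * c := by positivity
  have h3 : 0 < a + b * c * s := by positivity
  have key : C / (a + b * s) + t / (a + b * c) - 1 / (a + b * c * s) =
      a / (a + b * c * s) * (C * (1 - c) / (a + b * s)) +
        a / (a + b * c * s) * (t * (1 - s) / (a + b * c)) := by
    have e : 1 / (a + b * c * s) = C * c / (a + b * c * s) + s * t / (a + b * c * s) := by
      rw [← add_div, h]
    rw [e]
    field_simp
    ring
  have hr0 : 0 ≤ a / (a + b * c * s) := by positivity
  have hr1 : a / (a + b * c * s) ≤ 1 := by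
    rw [div_le_one h3]
    have : 0 ≤ b * c * s := by positivity
    linarith
  have hX0 : 0 ≤ C * (1 - c) / (a + b * s) :=
    div_nonneg (mul_nonneg hC0 (by linarith)) h1.le
  have hY0 : 0 ≤ t * (1 - s) / (a + b * c) :=
    div_nonneg (mul_nonneg ht0 (by linarith)) h2.le
  have hX1 : C * (1 - c) / (a + b * s) ≤ 1 / b := by
    rw [div_le_div_iff₀ h1 hb]
    have : C * (1 - c) ≤ s := by
      nlinarith [mul_le_mul_of_nonneg_right hC1 hc0, mul_le_mul_of_nonneg_left ht1 hs0,
        mul_le_mul_of_nonneg_right hC1 (sub_nonneg.2 hc1)]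
    nlinarith
  have hY1 : t * (1 - s) / (a + b * c) ≤ 1 / b := by
    rw [div_le_div_iff₀ h2 hb]
    have : t * (1 - s) ≤ c := by
      nlinarith [mul_le_mul_of_nonneg_right hC1 hc0, mul_le_mul_of_nonneg_left ht1 hs0,
        mul_le_mul_of_nonneg_right ht1 (sub_nonneg.2 hs1)]
    nlinarith
  rw [key]
  refine ⟨by positivity, ?_⟩
  have e : 2 / b = 1 / b + 1 / b := by ring
  rw [e]
  exact add_le_add ((mul_le_of_le_one_left hX0 hr1).trans hX1)
    ((mul_le_of_le_one_left hY0 hr1).trans hY1)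

lemma intervalIntegrable_arcsinP_integrand {p : ℝ} (hp : 1 < p) :
    IntervalIntegrable (fun s : ℝ => (1 - s ^ p) ^ (-1 / p)) volume 0 1 := by
  have hp0 : 0 < p := by linarith
  have h1 : IntervalIntegrable (fun s : ℝ => (1 - s) ^ (-1 / p)) volume 0 1 := by
    have h0 : IntervalIntegrable (fun s : ℝ => s ^ (-1 / p)) volume 0 1 := by
      apply intervalIntegral.intervalIntegrable_rpow'
      rw [lt_div_iff₀ hp0]
      linarith
    have := (h0.comp_sub_left 1).symm
    simpa using this
  refine h1.mono_fun' ?_ ?_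
  · apply Measurable.aestronglyMeasurable
    fun_prop
  · rw [uIoc_of_le zero_le_one, ← restrict_Ioo_eq_restrict_Ioc]
    refine (ae_restrict_iff' measurableSet_Ioo).2 (Filter.Eventually.of_forall fun s hs => ?_)
    have hsp : s ^ p ≤ s := by
      simpa using rpow_le_rpow_of_exponent_ge hs.1 hs.2.le hp.le
    have h2 : 0 < 1 - s := by linarith [hs.2]
    beta_reduce
    rw [Real.norm_of_nonneg (rpow_nonneg (by linarith) _)]
    refine rpow_le_rpow_of_nonpos h2 (by linarith) ?_
    exact div_nonpos_of_nonpos_of_nonneg (by norm_num) hp0.le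

lemma hasDerivAt_arcsinP {p x : ℝ} (hp : 1 < p) (hx : x ∈ Ioo (0:ℝ) 1) :
    HasDerivAt (arcsinP p) ((1 - x ^ p) ^ (-1 / p)) x := by
  have hpos : 0 < 1 - x ^ p := by
    linarith [rpow_lt_one hx.1.le hx.2 (by linarith : 0 < p)]
  refine intervalIntegral.integral_hasDerivAt_right ?_ ?_ ?_
  · refine (intervalIntegrable_arcsinP_integrand hp).mono_set ?_
    rw [uIcc_of_le hx.1.le, uIcc_of_le zero_le_one]
    exact Icc_subset_Icc_right hx.2.le
  · exact Measurable.stronglyMeasurable (by fun_prop) |>.stronglyMeasurableAtFilter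
  · have h1 : ContinuousAt (fun s : ℝ => 1 - s ^ p) x :=
      continuousAt_const.sub (continuousAt_rpow_const x p (Or.inl hx.1.ne'))
    exact h1.rpow_const (Or.inl hpos.ne')

lemma continuousOn_arcsinP {p : ℝ} (hp : 1 < p) : ContinuousOn (arcsinP p) (Icc 0 1) := by
  have := intervalIntegral.continuousOn_primitive_interval'
    (intervalIntegrable_arcsinP_integrand hp) (left_mem_uIcc)
  rwa [uIcc_of_le zero_le_one] at this

lemma strictMonoOn_arcsinP {p : ℝ} (hp : 1 < p) : StrictMonoOn (arcsinP p) (Icc 0 1) := by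
  refine strictMonoOn_of_deriv_pos (convex_Icc 0 1) (continuousOn_arcsinP hp) fun x hx => ?_
  rw [interior_Icc] at hx
  rw [(hasDerivAt_arcsinP hp hx).deriv]
  apply rpow_pos_of_pos
  linarith [rpow_lt_one hx.1.le hx.2 (by linarith : 0 < p)]

lemma arcsinP_zero (p : ℝ) : arcsinP p 0 = 0 := by simp [arcsinP]

lemma arcsinP_mem_Icc {p x : ℝ} (hp : 1 < p) (hx : x ∈ Icc (0:ℝ) 1) :
    arcsinP p x ∈ Icc (0:ℝ) (arcsinP p 1) := by
  have hm := (strictMonoOn_arcsinP hp).monotoneOn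
  constructor
  · rw [← arcsinP_zero p]
    exact hm (by simp) hx hx.1
  · exact hm hx (by simp) hx.2

section Inverse

variable {p T : ℝ} {S : ℝ → ℝ}

lemma continuousOn_of_inverse_arcsinP (hp : 1 < p) (hT : T = arcsinP p 1)
    (hmaps : ∀ t ∈ Icc (0:ℝ) T, S t ∈ Icc (0:ℝ) 1)
    (hleft : ∀ x ∈ Icc (0:ℝ) 1, S (arcsinP p x) = x)
    (hright : ∀ t ∈ Icc (0:ℝ) T, arcsinP p (S t) = t) :
    ContinuousOn S (Icc 0 T) := by
  let e : Icc (0:ℝ) 1 ≃ Icc (0:ℝ) T :=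
    { toFun := fun x => ⟨arcsinP p x, hT ▸ arcsinP_mem_Icc hp x.2⟩
      invFun := fun t => ⟨S t, hmaps t t.2⟩
      left_inv := fun x => Subtype.ext (hleft x x.2)
      right_inv := fun t => Subtype.ext (hright t t.2) }
  have he : Continuous e :=
    (continuousOn_iff_continuous_domRestrict.1 (continuousOn_arcsinP hp)).subtype_mk _
  have hs : Continuous e.symm := he.continuous_symm_of_equiv_compact_to_t2
  exact continuousOn_iff_continuous_domRestrict.2 (continuous_subtype_val.comp hs)

lemma mem_Ioo_of_inverse_arcsinP (hT : T = arcsinP p 1)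
    (hmaps : ∀ t ∈ Icc (0:ℝ) T, S t ∈ Icc (0:ℝ) 1)
    (hright : ∀ t ∈ Icc (0:ℝ) T, arcsinP p (S t) = t) {t : ℝ} (ht : t ∈ Ioo 0 T) :
    S t ∈ Ioo (0:ℝ) 1 := by
  have hm := hmaps t (Ioo_subset_Icc_self ht)
  have hr := hright t (Ioo_subset_Icc_self ht)
  refine ⟨lt_of_le_of_ne hm.1 fun h => ?_, lt_of_le_of_ne hm.2 fun h => ?_⟩
  · rw [← h, arcsinP_zero] at hr
    exact ht.1.ne hr
  · rw [h, ← hT] at hr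
    exact ht.2.ne hr.symm

lemma hasDerivAt_of_inverse_arcsinP (hp : 1 < p) (hT : T = arcsinP p 1)
    (hmaps : ∀ t ∈ Icc (0:ℝ) T, S t ∈ Icc (0:ℝ) 1)
    (hleft : ∀ x ∈ Icc (0:ℝ) 1, S (arcsinP p x) = x)
    (hright : ∀ t ∈ Icc (0:ℝ) T, arcsinP p (S t) = t) {t : ℝ} (ht : t ∈ Ioo 0 T) :
    HasDerivAt S ((1 - S t ^ p) ^ (1 / p)) t := by
  have hS := mem_Ioo_of_inverse_arcsinP hT hmaps hright ht
  have hpos : 0 < 1 - S t ^ p := by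
    linarith [rpow_lt_one hS.1.le hS.2 (by linarith : 0 < p)]
  have hnhds : Icc (0:ℝ) T ∈ nhds t := Icc_mem_nhds ht.1 ht.2
  have h := HasDerivAt.of_local_left_inverse
    ((continuousOn_of_inverse_arcsinP hp hT hmaps hleft hright).continuousAt hnhds)
    (hasDerivAt_arcsinP hp hS) (rpow_pos_of_pos hpos _).ne'
    (Filter.eventually_of_mem hnhds hright)
  rwa [← rpow_neg hpos.le, neg_div, neg_neg] at h

lemma hasDerivAt_cosP_rpow (hp : 1 < p) (hT : T = arcsinP p 1)
    (hmaps : ∀ t ∈ Icc (0:ℝ) T, S t ∈ Icc (0:ℝ) 1)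
    (hleft : ∀ x ∈ Icc (0:ℝ) 1, S (arcsinP p x) = x)
    (hright : ∀ t ∈ Icc (0:ℝ) T, arcsinP p (S t) = t) {t : ℝ} (ht : t ∈ Ioo 0 T) :
    HasDerivAt (fun u => ((1 - S u ^ p) ^ (1 / p)) ^ (p - 1)) (-((p - 1) * S t ^ (p - 1))) t := by
  have hp0 : 0 < p := by linarith
  have hS := mem_Ioo_of_inverse_arcsinP hT hmaps hright ht
  have hpos : 0 < 1 - S t ^ p := by
    linarith [rpow_lt_one hS.1.le hS.2 hp0]
  have hd := hasDerivAt_of_inverse_arcsinP hp hT hmaps hleft hright ht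
  have h := (((hd.rpow_const (p := p) (Or.inl hS.1.ne')).const_sub 1).rpow_const
    (p := 1 / p) (Or.inl hpos.ne')).rpow_const (p := p - 1)
    (Or.inl (rpow_pos_of_pos hpos _).ne')
  convert h using 1
  set y := 1 - S t ^ p with hy
  have e : y ^ (1 / p) * y ^ (1 / p - 1) * (y ^ (1 / p)) ^ (p - 1 - 1) = 1 := by
    rw [← rpow_mul hpos.le, ← rpow_add hpos, ← rpow_add hpos]
    have : 1 / p + (1 / p - 1) + 1 / p * (p - 1 - 1) = 0 := by
      field_simp
      ring
    rw [this, rpow_zero]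
  have hpp : p * (1 / p) = 1 := by field_simp
  linear_combination ((p - 1) * S t ^ (p - 1)) * (p * (1 / p)) * e +
    ((p - 1) * S t ^ (p - 1)) * hpp

lemma integral_defect_bounds (hp : 1 < p) (hT : T = arcsinP p 1)
    (hmaps : ∀ t ∈ Icc (0:ℝ) T, S t ∈ Icc (0:ℝ) 1)
    (hleft : ∀ x ∈ Icc (0:ℝ) 1, S (arcsinP p x) = x)
    (hright : ∀ t ∈ Icc (0:ℝ) T, arcsinP p (S t) = t) {a b : ℝ} (ha : 0 < a) (hb : 0 < b) :
    0 ≤ p / ((p - 1) * b) * log ((a + b) / a) - (∫ φ in (0:ℝ)..T,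
        1 / (a + b * ((1 - S φ ^ p) ^ (1 / p)) ^ (p - 1) * S φ)) ∧
    p / ((p - 1) * b) * log ((a + b) / a) - (∫ φ in (0:ℝ)..T,
        1 / (a + b * ((1 - S φ ^ p) ^ (1 / p)) ^ (p - 1) * S φ)) ≤ 2 / b * T := by
  have hp0 : 0 < p := by linarith
  have hp1 : 0 < p - 1 := by linarith
  have hT0 : 0 ≤ T := hT ▸ (arcsinP_mem_Icc hp (by simp : (1:ℝ) ∈ Icc (0:ℝ) 1)).1
  have hcS := continuousOn_of_inverse_arcsinP hp hT hmaps hleft hright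
  have hS0 : S 0 = 0 := by simpa [arcsinP_zero] using hleft 0 (by simp)
  have hST : S T = 1 := by rw [hT]; exact hleft 1 (by simp)
  have hy : ∀ t ∈ Icc (0:ℝ) T, 0 ≤ 1 - S t ^ p ∧ 1 - S t ^ p ≤ 1 := fun t ht =>
    ⟨sub_nonneg.2 (rpow_le_one (hmaps t ht).1 (hmaps t ht).2 hp0.le),
      sub_le_self _ (rpow_nonneg (hmaps t ht).1 _)⟩
  have hcC : ContinuousOn (fun t => (1 - S t ^ p) ^ (1 / p)) (Icc 0 T) :=
    (continuousOn_const.sub (hcS.rpow_const fun _ _ => Or.inr hp0.le)).rpow_const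
      fun _ _ => Or.inr (by positivity)
  have hcc : ContinuousOn (fun t => ((1 - S t ^ p) ^ (1 / p)) ^ (p - 1)) (Icc 0 T) :=
    hcC.rpow_const fun _ _ => Or.inr hp1.le
  have hcs : ContinuousOn (fun t => S t ^ (p - 1)) (Icc 0 T) :=
    hcS.rpow_const fun _ _ => Or.inr hp1.le
  have hC0 : ∀ t ∈ Icc (0:ℝ) T, 0 ≤ (1 - S t ^ p) ^ (1 / p) := fun t ht =>
    rpow_nonneg (hy t ht).1 _
  have hC1 : ∀ t ∈ Icc (0:ℝ) T, (1 - S t ^ p) ^ (1 / p) ≤ 1 := fun t ht =>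
    rpow_le_one (hy t ht).1 (hy t ht).2 (by positivity)
  have hc0 : ∀ t ∈ Icc (0:ℝ) T, 0 ≤ ((1 - S t ^ p) ^ (1 / p)) ^ (p - 1) := fun t ht =>
    rpow_nonneg (hC0 t ht) _
  have hd1 : ∀ t ∈ Icc (0:ℝ) T, 0 < a + b * S t := fun t ht => by
    have := mul_nonneg hb.le (hmaps t ht).1
    linarith
  have hd2 : ∀ t ∈ Icc (0:ℝ) T, 0 < a + b * ((1 - S t ^ p) ^ (1 / p)) ^ (p - 1) := fun t ht => by
    have := mul_nonneg hb.le (hc0 t ht)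
    linarith
  have hd3 : ∀ t ∈ Icc (0:ℝ) T,
      0 < a + b * ((1 - S t ^ p) ^ (1 / p)) ^ (p - 1) * S t := fun t ht => by
    have := mul_nonneg (mul_nonneg hb.le (hc0 t ht)) (hmaps t ht).1
    linarith
  have hcd1 : ContinuousOn (fun t => a + b * S t) (Icc 0 T) :=
    continuousOn_const.add (continuousOn_const.mul hcS)
  have hcd2 : ContinuousOn (fun t => a + b * ((1 - S t ^ p) ^ (1 / p)) ^ (p - 1)) (Icc 0 T) :=
    continuousOn_const.add (continuousOn_const.mul hcc)
  have hf1 : ContinuousOn (fun t => (1 - S t ^ p) ^ (1 / p) / (a + b * S t)) (Icc 0 T) :=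
    hcC.div hcd1 fun t ht => (hd1 t ht).ne'
  have hf2 : ContinuousOn (fun t => S t ^ (p - 1) /
      (a + b * ((1 - S t ^ p) ^ (1 / p)) ^ (p - 1))) (Icc 0 T) :=
    hcs.div hcd2 fun t ht => (hd2 t ht).ne'
  have hf3 : ContinuousOn (fun t => 1 /
      (a + b * ((1 - S t ^ p) ^ (1 / p)) ^ (p - 1) * S t)) (Icc 0 T) :=
    continuousOn_const.div
      (continuousOn_const.add ((continuousOn_const.mul hcc).mul hcS)) fun t ht => (hd3 t ht).ne'
  have hi1 := hf1.intervalIntegrable_of_Icc (μ := volume) hT0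
  have hi2 := hf2.intervalIntegrable_of_Icc (μ := volume) hT0
  have hi3 := hf3.intervalIntegrable_of_Icc (μ := volume) hT0
  have hI1 : ∫ t in (0:ℝ)..T, (1 - S t ^ p) ^ (1 / p) / (a + b * S t) =
      1 / b * log ((a + b) / a) := by
    rw [intervalIntegral.integral_eq_sub_of_hasDerivAt_of_le hT0
      (f := fun t => 1 / b * log (a + b * S t))
      (continuousOn_const.mul (hcd1.log fun t ht => (hd1 t ht).ne')) (fun t ht => ?_) hi1]
    · rw [hS0, hST, log_div (by positivity) ha.ne']
      simp only [mul_one, mul_zero, add_zero]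
      ring
    · have h := (((hasDerivAt_of_inverse_arcsinP hp hT hmaps hleft hright ht).const_mul
        b).const_add a).log (hd1 t (Ioo_subset_Icc_self ht)).ne' |>.const_mul (1 / b)
      refine h.congr_deriv ?_
      have := (hd1 t (Ioo_subset_Icc_self ht)).ne'
      field_simp
  have hI2 : ∫ t in (0:ℝ)..T, S t ^ (p - 1) / (a + b * ((1 - S t ^ p) ^ (1 / p)) ^ (p - 1)) =
      1 / ((p - 1) * b) * log ((a + b) / a) := by
    rw [intervalIntegral.integral_eq_sub_of_hasDerivAt_of_le hT0
      (f := fun t => -(1 / ((p - 1) * b)) * log (a + b * ((1 - S t ^ p) ^ (1 / p)) ^ (p - 1)))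
      (continuousOn_const.mul (hcd2.log fun t ht => (hd2 t ht).ne')) (fun t ht => ?_) hi2]
    · have h1 : ((1 - S T ^ p) ^ (1 / p)) ^ (p - 1) = 0 := by
        rw [hST, one_rpow, sub_self, zero_rpow (by positivity), zero_rpow hp1.ne']
      have h2 : ((1 - S 0 ^ p) ^ (1 / p)) ^ (p - 1) = 1 := by
        rw [hS0, zero_rpow hp0.ne', sub_zero, one_rpow, one_rpow]
      rw [h1, h2, log_div (by positivity) ha.ne']
      simp only [mul_one, mul_zero, add_zero]
      ring
    · have h := (((hasDerivAt_cosP_rpow hp hT hmaps hleft hright ht).const_mul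
        b).const_add a).log (hd2 t (Ioo_subset_Icc_self ht)).ne' |>.const_mul
          (-(1 / ((p - 1) * b)))
      refine h.congr_deriv ?_
      have := (hd2 t (Ioo_subset_Icc_self ht)).ne'
      field_simp
  have hsum : p / ((p - 1) * b) * log ((a + b) / a) =
      1 / b * log ((a + b) / a) + 1 / ((p - 1) * b) * log ((a + b) / a) := by
    field_simp
    ring
  rw [hsum, ← hI1, ← hI2, ← intervalIntegral.integral_add hi1 hi2,
    ← intervalIntegral.integral_sub (hi1.add hi2) hi3]
  have hbd := fun t (ht : t ∈ Icc (0:ℝ) T) =>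
    weighted_inv_defect_bounds ha hb (hmaps t ht).1 (hmaps t ht).2
      (rpow_nonneg (hmaps t ht).1 _) (rpow_le_one (hmaps t ht).1 (hmaps t ht).2 hp1.le)
      (hC0 t ht) (hC1 t ht) (hc0 t ht) (rpow_le_one (hC0 t ht) (hC1 t ht) hp1.le) (by
        have hmul : ∀ x : ℝ, 0 ≤ x → x * x ^ (p - 1) = x ^ p := fun x hx => by
          rw [mul_comm, ← rpow_add_one' hx (by linarith), sub_add_cancel]
        rw [hmul _ (hC0 t ht), hmul _ (hmaps t ht).1, ← rpow_mul (hy t ht).1,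
          one_div_mul_cancel hp0.ne', rpow_one, sub_add_cancel])
  constructor
  · exact intervalIntegral.integral_nonneg hT0 fun t ht => (hbd t ht).1
  · refine (intervalIntegral.integral_mono_on hT0 ((hi1.add hi2).sub hi3)
      (intervalIntegrable_const (c := 2 / b)) fun t ht => (hbd t ht).2).trans ?_
    rw [intervalIntegral.integral_const, smul_eq_mul, sub_zero, mul_comm]

end Inverse

/-- for `p > 1` and `β > 0`, letting `α(D)` be the unique positive solution
of `∫₀^{π_p/2} dφ/(α + β cos_p(φ)^(p-1) sin_p(φ)) = D` and `λ̄(D) = (p-1) α(D)^p`, there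
are `C > 0` and `D₀ > 0` such that for all `D > D₀`, `|ln λ̄(D) + (p-1) β D| ≤ C`. -/
theorem stmt9 (p β : ℝ) (hp : 1 < p) (hβ : 0 < β) (sinp : ℝ → ℝ)
    (hmaps : ∀ t ∈ Icc (0:ℝ) (piP p / 2), sinp t ∈ Icc (0:ℝ) 1)
    (hleft : ∀ x ∈ Icc (0:ℝ) 1, sinp (arcsinP p x) = x)
    (hright : ∀ t ∈ Icc (0:ℝ) (piP p / 2), arcsinP p (sinp t) = t)
    (α : ℝ → ℝ)
    (hα : ∀ D : ℝ, 0 < D → 0 < α D ∧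
      (∫ φ in (0:ℝ)..(piP p / 2),
        1 / (α D + β * ((1 - sinp φ ^ p) ^ (1 / p)) ^ (p - 1) * sinp φ)) = D) :
    ∃ C > (0:ℝ), ∃ D₀ > (0:ℝ), ∀ D : ℝ, D₀ < D →
      |Real.log ((p - 1) * α D ^ p) + (p - 1) * β * D| ≤ C := by
  have hT : piP p / 2 = arcsinP p 1 := by
    rw [piP]
    ring
  have hp0 : 0 < p := by linarith
  have hp1 : 0 < p - 1 := by linarith
  have hT0 : 0 ≤ piP p / 2 := hT ▸ (arcsinP_mem_Icc hp (by simp : (1:ℝ) ∈ Icc (0:ℝ) 1)).1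
  refine ⟨|log (p - 1)| + 2 * (p - 1) * (piP p / 2) +
    p * (|log β| + |log (p / (p - 1) + β)|) + 1, by positivity, 1, one_pos, fun D hD => ?_⟩
  obtain ⟨ha, hI⟩ := hα D (by linarith)
  obtain ⟨h0, h1⟩ := integral_defect_bounds hp hT hmaps hleft hright ha hβ
  rw [hI] at h0 h1
  set a := α D
  have hab : 0 < a + β := by positivity
  have hlog : log ((a + β) / a) ≤ β / a := by
    refine (log_le_sub_one_of_pos (by positivity)).trans (le_of_eq ?_)
    field_simp
    ring
  have haM : a ≤ p / (p - 1) := by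
    have h2 : 1 ≤ p / ((p - 1) * β) * (β / a) :=
      le_trans (by linarith) (mul_le_mul_of_nonneg_left hlog (by positivity))
    have h3 : p / ((p - 1) * β) * (β / a) = p / (p - 1) / a := by field_simp
    rwa [h3, one_le_div ha] at h2
  have hl1 : log β ≤ log (a + β) := log_le_log hβ (by linarith)
  have hl2 : log (a + β) ≤ log (p / (p - 1) + β) := log_le_log hab (by linarith)
  have hl : |log (a + β)| ≤ |log β| + |log (p / (p - 1) + β)| := by
    rw [abs_le]
    constructor
    · linarith [neg_abs_le (log β), abs_nonneg (log (p / (p - 1) + β))]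
    · linarith [le_abs_self (log (p / (p - 1) + β)), abs_nonneg (log β)]
  set E := p / ((p - 1) * β) * log ((a + β) / a) - D with hE
  have hmain : log ((p - 1) * a ^ p) + (p - 1) * β * D =
      log (p - 1) - (p - 1) * β * E + p * log (a + β) := by
    rw [hE, log_mul hp1.ne' (rpow_pos_of_pos ha p).ne', log_rpow ha, log_div hab.ne' ha.ne']
    field_simp
    ring
  have hE0 : 0 ≤ (p - 1) * β * E := by positivity
  have hE1 : (p - 1) * β * E ≤ 2 * (p - 1) * (piP p / 2) := by
    refine (mul_le_mul_of_nonneg_left h1 (by positivity)).trans (le_of_eq ?_)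
    field_simp
  have hpl : |p * log (a + β)| ≤ p * (|log β| + |log (p / (p - 1) + β)|) := by
    rw [abs_mul, abs_of_pos hp0]
    exact mul_le_mul_of_nonneg_left hl hp0.le
  rw [hmain, abs_le]
  have := abs_le.1 hpl
  constructor
  · linarith [neg_abs_le (log (p - 1))]
  · linarith [le_abs_self (log (p - 1))]
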